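/- In R = MvPolynomial (Fin 8) ℤ, the second elementary symmetric function of the multiset W((2,2,2,2,2,2,2), 8) of weights of semistandard Young tableaux of shape (2,2,2,2,2,2,2) with entries in {0,…,7} is congruent to 10·e₂ modulo the ideal generated by e₁; equivalently, c₂(γ₈^{(2,2,2,2,2,2,2)}) = 10·c₂(γ₈), the Table 1 entry for the weight 2α₇ of SL₈/μ₂. -/

import Mathlib

open MvPolynomial

open scoped Classical in
/-- The multiset `W(lam, n)` of weights of semistandard Young tableaux of shape
`lam` (a list of row lengths) with entries in `{0, …, n-1}`: a tableau assigns
to each cell `(i, j)` of the Young diagram of `lam` an entry in `Fin n`, weakly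
increasing along rows and strictly increasing down columns; its weight is the
sum `∑_{(i,j) ∈ lam} X_{T(i,j)}`. -/
noncomputable def ssytWeights (lam : List ℕ) (n : ℕ) :
    Multiset (MvPolynomial (Fin n) ℤ) :=
  ((Finset.univ : Finset ((i : Fin lam.length) → Fin (lam.get i) → Fin n)).filter
      (fun T =>
        (∀ (i : Fin lam.length) (j j' : Fin (lam.get i)), (j : ℕ) ≤ (j' : ℕ) → T i j ≤ T i j') ∧
        (∀ (i i' : Fin lam.length), (i : ℕ) < (i' : ℕ) →
          ∀ (j : Fin (lam.get i')) (hj : (j : ℕ) < lam.get i), T i ⟨j, hj⟩ < T i' j))).val.map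
    (fun T => ∑ i, ∑ j, MvPolynomial.X (T i j))

theorem Multiset.esymm_two_cons {R : Type*} [CommSemiring R] (a : R) (s : Multiset R) :
    (a ::ₘ s).esymm 2 = s.esymm 2 + a * s.sum := by
  simp only [Multiset.esymm, Multiset.powersetCard_cons, Multiset.powersetCard_one,
    Multiset.map_map, Function.comp_def, Multiset.map_add, Multiset.sum_add,
    Multiset.prod_cons, Multiset.prod_singleton]
  rw [Multiset.sum_map_mul_left (f := fun x => x), Multiset.map_id']

theorem Multiset.two_mul_esymm_two {R : Type*} [CommRing R] (s : Multiset R) :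
    2 * s.esymm 2 = s.sum ^ 2 - (s.map (· ^ 2)).sum := by
  induction s using Multiset.induction_on with
  | empty => simp [Multiset.esymm, Multiset.powersetCard_zero_right 1]
  | cons a s ih =>
    rw [Multiset.esymm_two_cons, mul_add, ih]
    simp only [Multiset.sum_cons, Multiset.map_cons]
    ring

theorem Finset.two_mul_sum_le_of_symm {ι R : Type*} [Fintype ι] [LinearOrder ι] [CommRing R]
    (g : ι → ι → R) (hg : ∀ a b, g a b = g b a) :
    2 * ∑ p : ι × ι with p.2 ≤ p.1, g p.1 p.2 = ∑ a, ∑ b, g a b + ∑ a, g a a := by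
  have hswap : ∑ a, ∑ b, (if b ≤ a then g a b else 0) =
      ∑ a, ∑ b, (if a ≤ b then g a b else 0) := by
    rw [Finset.sum_comm]
    simp only [hg]
  have hdiag : ∑ a, g a a = ∑ a, ∑ b, (if a = b then g a b else 0) := by simp
  rw [Finset.sum_filter, Fintype.sum_prod_type, two_mul, hdiag]
  nth_rewrite 1 [hswap]
  simp only [← Finset.sum_add_distrib]
  refine Finset.sum_congr rfl fun a _ => Finset.sum_congr rfl fun b _ => ?_
  rcases lt_trichotomy a b with h | rfl | h
  · simp [h.le, h.ne, h.not_ge]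
  · simp
  · simp [h.le, h.ne', h.not_ge]

/-- The only strictly monotone maps `Fin n → Fin (n + 1)` are the `Fin.succAbove` maps. -/
theorem Fin.exists_eq_succAbove_of_strictMono {n : ℕ} {f : Fin n → Fin (n + 1)}
    (hf : StrictMono f) : ∃ m, f = Fin.succAbove m := by
  obtain ⟨m, hm⟩ : ∃ m, ∀ i, f i ≠ m := by
    by_contra! h
    have := Fintype.card_le_of_surjective f h
    simp at this
  choose g hg using fun i => Fin.exists_succAbove_eq (hm i)
  have hmono : StrictMono g := fun i j hij => by
    rw [← (Fin.strictMono_succAbove m).lt_iff_lt, hg, hg]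
    exact hf hij
  refine ⟨m, funext fun i => ?_⟩
  have : g = id := by
    refine (StrictMono.range_inj hmono strictMono_id).1 ?_
    rw [(Finite.surjective_of_injective hmono.injective).range_eq, Set.range_id]
  rw [← hg i, this, id]

theorem Fin.forall_succAbove_le_succAbove_iff {n : ℕ} {a b : Fin (n + 1)} :
    (∀ i, a.succAbove i ≤ b.succAbove i) ↔ b ≤ a := by
  constructor
  · intro h
    by_contra! hab
    have hlt : (a : ℕ) < n := by omega
    have := h ⟨a, hlt⟩
    rw [Fin.succAbove_of_le_castSucc a ⟨a, hlt⟩ le_rfl,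
      Fin.succAbove_of_castSucc_lt b ⟨a, hlt⟩ hab] at this
    exact absurd this (Fin.castSucc_lt_succ).not_ge
  · intro h i
    simp only [Fin.succAbove, Fin.lt_def, Fin.le_def] at *
    split_ifs <;> grind

/-- The filling of a two-column shape whose first and second columns list, in order, all entries
except `p.1` and `p.2` respectively. -/
def twoColumnFilling (lam : List ℕ) (p : Fin (lam.length + 1) × Fin (lam.length + 1)) :
    (i : Fin lam.length) → Fin (lam.get i) → Fin (lam.length + 1) :=
  fun i j => if (j : ℕ) = 0 then p.1.succAbove i else p.2.succAbove i

theorem twoColumnFilling_injective {lam : List ℕ} (h : ∀ i, lam.get i = 2) :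
    Function.Injective (twoColumnFilling lam) := by
  intro p q hpq
  refine Prod.ext (Fin.succAbove_left_injective ?_) (Fin.succAbove_left_injective ?_) <;>
    funext i
  · simpa [twoColumnFilling] using congrFun (congrFun hpq i) ⟨0, by rw [h]; norm_num⟩
  · simpa [twoColumnFilling] using congrFun (congrFun hpq i) ⟨1, by rw [h]; norm_num⟩

theorem isSsyt_iff_exists_twoColumnFilling {lam : List ℕ} (h : ∀ i, lam.get i = 2)
    (T : (i : Fin lam.length) → Fin (lam.get i) → Fin (lam.length + 1)) :
    ((∀ (i : Fin lam.length) (j j' : Fin (lam.get i)), (j : ℕ) ≤ (j' : ℕ) → T i j ≤ T i j') ∧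
      (∀ (i i' : Fin lam.length), (i : ℕ) < (i' : ℕ) →
        ∀ (j : Fin (lam.get i')) (hj : (j : ℕ) < lam.get i), T i ⟨j, hj⟩ < T i' j)) ↔
    ∃ p : Fin (lam.length + 1) × Fin (lam.length + 1),
      p.2 ≤ p.1 ∧ twoColumnFilling lam p = T := by
  have h0 : ∀ i, 0 < lam.get i := fun i => by rw [h]; norm_num
  have h1 : ∀ i, 1 < lam.get i := fun i => by rw [h]; norm_num
  constructor
  · rintro ⟨hrow, hcol⟩
    obtain ⟨a, ha⟩ := Fin.exists_eq_succAbove_of_strictMono (f := fun i => T i ⟨0, h0 i⟩)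
      fun i i' hi => hcol i i' hi ⟨0, h0 i'⟩ (h0 i)
    obtain ⟨b, hb⟩ := Fin.exists_eq_succAbove_of_strictMono (f := fun i => T i ⟨1, h1 i⟩)
      fun i i' hi => hcol i i' hi ⟨1, h1 i'⟩ (h1 i)
    refine ⟨(a, b), Fin.forall_succAbove_le_succAbove_iff.1 fun i => ?_, ?_⟩
    · rw [← ha, ← hb]
      exact hrow i _ _ (Nat.zero_le 1)
    · funext i ⟨j, hj⟩
      have hj2 : j < 2 := h i ▸ hj
      interval_cases j
      · simp [twoColumnFilling, ← ha]
      · simp [twoColumnFilling, ← hb]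
  · rintro ⟨⟨a, b⟩, hab, rfl⟩
    refine ⟨fun i j j' hjj' => ?_, fun i i' hi j hj => ?_⟩
    · have := Fin.forall_succAbove_le_succAbove_iff.2 hab i
      unfold twoColumnFilling
      split_ifs
      · exact le_rfl
      · exact this
      · omega
      · exact le_rfl
    · unfold twoColumnFilling
      dsimp only
      split_ifs
      · exact Fin.strictMono_succAbove a hi
      · exact Fin.strictMono_succAbove b hi

theorem sum_X_twoColumnFilling {lam : List ℕ} (h : ∀ i, lam.get i = 2)
    (p : Fin (lam.length + 1) × Fin (lam.length + 1)) :
    ∑ i, ∑ j, (X (twoColumnFilling lam p i j) : MvPolynomial (Fin (lam.length + 1)) ℤ) =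
      2 * ∑ k, X k - X p.1 - X p.2 := by
  have hsum {k : ℕ} (hk : k = 2) (F : ℕ → MvPolynomial (Fin (lam.length + 1)) ℤ) :
      ∑ j : Fin k, F j = F 0 + F 1 := by
    subst hk
    simp
  have hrow (i : Fin lam.length) :
      ∑ j, (X (twoColumnFilling lam p i j) : MvPolynomial (Fin (lam.length + 1)) ℤ) =
        X (p.1.succAbove i) + X (p.2.succAbove i) := by
    simpa [twoColumnFilling] using
      hsum (h i) fun j => X (if j = 0 then p.1.succAbove i else p.2.succAbove i)
  have hone (a : Fin (lam.length + 1)) := Fin.sum_univ_succAbove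
    (fun k => (X k : MvPolynomial (Fin (lam.length + 1)) ℤ)) a
  simp only [hrow, Finset.sum_add_distrib]
  linear_combination -hone p.1 - hone p.2

theorem ssytWeights_two_columns {lam : List ℕ} (h : ∀ i, lam.get i = 2) :
    ssytWeights lam (lam.length + 1) =
      (Finset.univ.filter fun p : Fin (lam.length + 1) × Fin (lam.length + 1) =>
        p.2 ≤ p.1).val.map fun p => 2 * ∑ k, X k - X p.1 - X p.2 := by
  classical
  simp only [← sum_X_twoColumnFilling h]
  have himage : (Finset.univ.filter fun p : Fin (lam.length + 1) × Fin (lam.length + 1) =>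
      p.2 ≤ p.1).map ⟨_, twoColumnFilling_injective h⟩ = Finset.univ.filter fun T =>
        (∀ (i : Fin lam.length) (j j' : Fin (lam.get i)),
          (j : ℕ) ≤ (j' : ℕ) → T i j ≤ T i j') ∧
        (∀ (i i' : Fin lam.length), (i : ℕ) < (i' : ℕ) →
          ∀ (j : Fin (lam.get i')) (hj : (j : ℕ) < lam.get i), T i ⟨j, hj⟩ < T i' j) := by
    ext T
    simp only [Finset.mem_map, Finset.mem_filter, Finset.mem_univ, true_and,
      Function.Embedding.coeFn_mk]
    exact (isSsyt_iff_exists_twoColumnFilling h T).symm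
  unfold ssytWeights
  convert congrArg (fun s => s.val.map fun T => ∑ i, ∑ j,
    (X (T i j) : MvPolynomial (Fin (lam.length + 1)) ℤ)) himage.symm using 1
  simp [Finset.map_val, Multiset.map_map]

theorem four_mul_esymm_two_pairs {R : Type*} [CommRing R] {n : ℕ} (x : Fin n → R) :
    4 * (((Finset.univ.filter fun p : Fin n × Fin n => p.2 ≤ p.1).val.map
      fun p => 2 * ∑ k, x k - x p.1 - x p.2).esymm 2) =
      2 * ((n ^ 2 - 1) ^ 2 - (2 * n ^ 2 - n - 1)) * (∑ k, x k) ^ 2 +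
        4 * (n + 2) * (Finset.univ.val.map x).esymm 2 := by
  set e := ∑ k, x k with he
  have hS := Finset.two_mul_sum_le_of_symm (fun a b : Fin n => 2 * e - x a - x b)
    fun a b => by ring
  have hQ := Finset.two_mul_sum_le_of_symm (fun a b : Fin n => (2 * e - x a - x b) ^ 2)
    fun a b => by ring
  have hp := Multiset.two_mul_esymm_two (Finset.univ.val.map x)
  have hE := Multiset.two_mul_esymm_two ((Finset.univ.filter fun p : Fin n × Fin n =>
    p.2 ≤ p.1).val.map fun p => 2 * e - x p.1 - x p.2)
  simp only [Multiset.map_map, Function.comp_def, Finset.sum_map_val] at hp hE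
  beta_reduce at hS hQ
  set S := ∑ p : Fin n × Fin n with p.2 ≤ p.1, (2 * e - x p.1 - x p.2)
  set Q := ∑ p : Fin n × Fin n with p.2 ≤ p.1, (2 * e - x p.1 - x p.2) ^ 2
  have hsq (a b : Fin n) : (2 * e - x a - x b) ^ 2 =
      4 * e ^ 2 - 4 * e * x a - 4 * e * x b + x a ^ 2 + x b ^ 2 + 2 * (x a * x b) := by ring
  simp only [hsq, Finset.sum_add_distrib, Finset.sum_sub_distrib, ← Finset.mul_sum,
    ← Finset.sum_mul, Finset.sum_const, Finset.card_univ, Fintype.card_fin, nsmul_eq_mul,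
    ← he, ← pow_two] at hS hQ hp
  linear_combination 2 * hE + (S + (n ^ 2 - 1) * e) * hS - hQ - 2 * (n + 2) * hp

/-- `c₂(γ8^[2, 2, 2, 2, 2, 2, 2]) = 10·c₂(γ8)`: the second elementary symmetric function of
the multiset of weights of semistandard Young tableaux of shape `[2, 2, 2, 2, 2, 2, 2]` with
entries in `{0, …, 7}` is congruent to `10·e₂` modulo the ideal generated
by `e₁`. -/
theorem c2_ssyt_stmt6 :
    Multiset.esymm (ssytWeights [2, 2, 2, 2, 2, 2, 2] 8) 2 - 10 * esymm (Fin 8) ℤ 2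
      ∈ Ideal.span {esymm (Fin 8) ℤ 1} := by
  have hW := ssytWeights_two_columns (lam := [2, 2, 2, 2, 2, 2, 2]) (by decide)
  have hE := four_mul_esymm_two_pairs (fun k => (X k : MvPolynomial (Fin 8) ℤ))
  change ssytWeights [2, 2, 2, 2, 2, 2, 2] 8 = _ at hW
  rw [Ideal.mem_span_singleton', esymm_one, esymm_eq_multiset_esymm]
  refine ⟨1925 * ∑ k, X k, ?_⟩
  have h4 : (4 : MvPolynomial (Fin 8) ℤ) ≠ 0 := by norm_num
  refine mul_left_cancel₀ h4 ?_
  rw [hW]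
  push_cast at hE
  linear_combination -hE
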